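/- Let (Δ,Θ) be a directive bi-sequence with associated prefixes (w_n) and let n ≥ 3. Suppose the prefix of length n of (Δ,Θ) is normalized, and suppose there exist pairwise distinct letters i, j, k ∈ {0,1,2} such that (ϑ_{n−2}, ϑ_{n−1}, ϑ_n, ϑ_{n+1}) = (E_i, E_j, E_k, E_k) and E_i(δ_{n−1}) = E_j(δ_n) = E_k(δ_{n+1}) (the E's applied to letters). Then exactly two pseudopalindromic prefixes are missed between w_n and w_{n+1}; moreover w_{n+1} = w_{n−1}·(E_j(w_{n−2}))⁻¹·E_k(w_{n−1})·(E_k(w_{n−2}))⁻¹·E_i(w_{n−1})·(w_{n−2})⁻¹·w_{n−1}·(E_j(w_{n−2}))⁻¹·E_k(w_{n−1}), where x·y⁻¹·z denotes x with its suffix y removed followed by z (each displayed deletion removing a suffix of the word built so far), and the two missed pseudopalindromic prefixes are w_{n−1}(E_j(w_{n−2}))⁻¹E_k(w_{n−1})(E_k(w_{n−2}))⁻¹E_i(w_{n−1}), which is an E_i-palindrome, and w_{n−1}(E_j(w_{n−2}))⁻¹E_k(w_{n−1})(E_k(w_{n−2}))⁻¹E_i(w_{n−1})(w_{n−2})⁻¹w_{n−1},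 which is an E_j-palindrome. -/

import Mathlib

/-- The ternary alphabet. -/
abbrev Letter := Fin 3

/-- Finite words over the ternary alphabet. -/
abbrev Word := List Letter

/-- The four involutory antimorphisms of ternary words: the reversal `R`
and, for each letter `i`, the antimorphism `E i`. -/
inductive AM where
  | R : AM
  | E : Letter → AM
deriving DecidableEq

/-- The action of an antimorphism on a single letter: `R` fixes every letter,
and `E i` fixes `i` and exchanges the other two letters (in `Fin 3`,
this involution is `a ↦ -(i + a)`). -/
def AM.letter : AM → Letter → Letter
  | .R, _a => _a
  | .E i, a => -(i + a)

/-- The action of an antimorphism on a word: letterwise image followed by reversal. -/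
def AM.apply (t : AM) (w : Word) : Word := (w.map t.letter).reverse

/-- A word is a pseudopalindrome if it is a `ϑ`-palindrome for some
`ϑ ∈ {R, E_0, E_1, E_2}`. -/
def IsPseudopal (w : Word) : Prop := ∃ t : AM, t.apply w = w

/-- `v` is an image of `w` if `v = ϑ(w)` for some `ϑ ∈ {R, E_0, E_1, E_2}`. -/
def IsImage (w v : Word) : Prop := ∃ t : AM, v = t.apply w

/-- `v` is the `ϑ`-palindromic closure of `u`: the shortest `ϑ`-palindrome
having `u` as a prefix. -/
def IsPalClosure (t : AM) (u v : Word) : Prop :=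
  u <+: v ∧ t.apply v = v ∧
    ∀ v' : Word, u <+: v' → t.apply v' = v' → v.length ≤ v'.length

/-- `w` is the sequence of prefixes associated with the directive bi-sequence
`(Δ, Θ)`: `w 0 = ε` and `w (n+1) = (w n · δ_{n+1})^{ϑ_{n+1}}`. -/
def DirectivePrefixes (Δ : ℕ → Letter) (Θ : ℕ → AM) (w : ℕ → Word) : Prop :=
  w 0 = [] ∧ ∀ n : ℕ, IsPalClosure (Θ (n + 1)) (w n ++ [Δ (n + 1)]) (w (n + 1))

/-- A pseudopalindromic prefix `v` of `w_{n+1}` is missed between `w_n` and `w_{n+1}`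
if `|w_n| < |v| < |w_{n+1}|`. -/
def MissedBetween (wn wn1 v : Word) : Prop :=
  v <+: wn1 ∧ IsPseudopal v ∧ wn.length < v.length ∧ v.length < wn1.length

/-- An image of `u` occurs in `v` at (0-indexed) position `p`. -/
def OccursImageAt (u v : Word) (p : ℕ) : Prop :=
  p + u.length ≤ v.length ∧ IsImage u ((v.drop p).take u.length)

/-- Assumption A for the pair `(wn, wn1)`: some image of `wn` occurs in `wn1`
at a position `p` with `0 < p < |wn1| - |wn|`, overlapping both the prefix
occurrence of `wn` and the suffix occurrence of an image of `wn`. -/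
def AssumptionA (wn wn1 : Word) : Prop :=
  ∃ p : ℕ, 0 < p ∧ p < wn1.length - wn.length ∧ p < wn.length ∧
    wn1.length - wn.length < p + wn.length ∧ OccursImageAt wn wn1 p

/-- The prefix of length `n` of the directive bi-sequence is normalized:
every pseudopalindromic prefix of `w n` equals `w k` for some `k ≤ n`. -/
def NormalizedUpTo (w : ℕ → Word) (n : ℕ) : Prop :=
  ∀ v : Word, v <+: w n → IsPseudopal v → ∃ k : ℕ, k ≤ n ∧ v = w k

/-- `rep u l` is the `l`-fold concatenation `u^l`. -/
def rep (u : Word) (l : ℕ) : Word := (List.replicate l u).flatten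

/-- `rmSuf x y` is `x · y⁻¹`: the word `x` with its suffix of length `|y|` removed. -/
def rmSuf (x y : Word) : Word := x.take (x.length - y.length)

/-- `v` is a prefix of the infinite periodic word `pat^ω`. -/
def IsPrefixOfPow (pat v : Word) : Prop :=
  ∀ q : ℕ, ∀ hq : q < v.length, ∃ hp : q % pat.length < pat.length,
    v.get ⟨q, hq⟩ = pat.get ⟨q % pat.length, hp⟩

/-- The prefix of length `N` of the infinite word `W` is an `E s`-palindrome. -/
def PalAt (W : ℕ → Letter) (s : Letter) (N : ℕ) : Prop :=
  ∀ a b : ℕ, a + b + 1 = N → W a + W b + s = 0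

/-- The word `W 0 ⋯ W M` is a prefix of some `E s`-palindrome of length `N`, where `N ≤ 2M + 2`. -/
def ExtendsTo (W : ℕ → Letter) (s : Letter) (M N : ℕ) : Prop :=
  ∀ a b : ℕ, a ≤ M → b ≤ M → a + b + 1 = N → W a + W b + s = 0

/-- The prefix of length `N` of the infinite word `W`. -/
def pre (W : ℕ → Letter) (N : ℕ) : Word := (List.range N).map W

/-- `N` is the length of the `E s`-palindromic closure of `W 0 ⋯ W M`, itself a prefix of `W`. -/
structure ClosureAt (W : ℕ → Letter) (s : Letter) (M N : ℕ) : Prop where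
  lt : M < N
  pal : PalAt W s N
  min : ∀ N', M < N' → N' ≤ 2 * M + 2 → ExtendsTo W s M N' → N ≤ N'

theorem ClosureAt.le {W : ℕ → Letter} {s : Letter} {M N : ℕ} (h : ClosureAt W s M N) :
    N ≤ 2 * M + 2 :=
  h.min _ (by omega) le_rfl fun a b _ _ _ => by omega

theorem letter_three_eq_zero : (3 : Letter) = 0 := rfl

section Core

variable {W : ℕ → Letter} {i j k : Letter} {X Y Z V : ℕ}

theorem second_length (hs : i + j + k = 0) (hX : PalAt W i X) (hY : ClosureAt W j X Y)
    (hZ : ClosureAt W k Y Z) (hXY : i + W X = j + W Y)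
    (hnorm : ∀ s N, X < N → N ≤ Z → PalAt W s N → N = Y ∨ N = Z) : Z + X = 2 * Y := by
  have h3 := letter_three_eq_zero
  have hlt := hY.lt
  have hlt' := hZ.lt
  refine le_antisymm ?_ ?_
  · have key : ∀ b, b ≤ Y → Y + b + 1 = 2 * Y - X → W Y + W b + k = 0 := fun b _ hb => by
      have h1 := hY.pal X b (by omega)
      grind
    have := hZ.min (2 * Y - X) (by omega) (by omega) fun a b ha hb hab => by
      rcases ha.eq_or_lt with rfl | ha
      · exact key b hb hab
      rcases hb.eq_or_lt with rfl | hb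
      · rw [add_comm (W a)]
        exact key a ha.le (by omega)
      have h1 := hY.pal a (Y - 1 - a) (by omega)
      have h2 := hY.pal b (Y - 1 - b) (by omega)
      have h4 := hX (Y - 1 - a) (Y - 1 - b) (by omega)
      grind
    omega
  · by_contra! hlt2
    have := hnorm i (2 * Y - Z) (by omega) (by omega) fun a b hab => by
      have h1 := hY.pal a (Y - 1 - a) (by omega)
      have h2 := hY.pal b (Y - 1 - b) (by omega)
      have h4 := hZ.pal (Y - 1 - a) (Y - 1 - b) (by omega)
      grind
    omega

theorem third_length (hs : i + j + k = 0) (hjk : j ≠ k) (hik : i ≠ k)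
    (hX : PalAt W i X) (hY : ClosureAt W j X Y)
    (hZ : ClosureAt W k Y Z) (hV : ClosureAt W k Z V)
    (hXY : i + W X = j + W Y) (hYZ : j + W Y = k + W Z) (hZX : Z + X = 2 * Y)
    (hnorm : ∀ s N, X < N → N ≤ Z → PalAt W s N → N = Y ∨ N = Z) :
    V + 4 * X = 5 * Y := by
  have h3 := letter_three_eq_zero
  have hltY := hY.lt
  have hltZ := hZ.lt
  have hltV := hV.lt
  have hleY := hY.le
  have hleV := hV.le
  refine le_antisymm ?_ ?_
  · have key : ∀ b, b ≤ Z → Z + b + 1 = 5 * Y - 4 * X → W Z + W b + k = 0 := fun b hb hb' => by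
      rcases hb.eq_or_lt with rfl | hb
      · have h1 := hY.pal X X (by omega)
        grind
      have h1 := hZ.pal b (2 * X - Y) (by omega)
      have h2 := hX (2 * X - Y) (Y - X - 1) (by omega)
      have h4 := hY.pal (Y - X - 1) X (by omega)
      grind
    have := hV.min (5 * Y - 4 * X) (by omega) (by omega) fun a b ha hb hab => by
      rcases ha.eq_or_lt with rfl | ha
      · exact key b hb hab
      rcases hb.eq_or_lt with rfl | hb
      · rw [add_comm (W a)]
        exact key a ha.le (by omega)
      have h1 := hZ.pal a (Z - 1 - a) (by omega)
      have h2 := hZ.pal b (Z - 1 - b) (by omega)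
      have h4 := hX (Z - 1 - a) (X - 1 - (Z - 1 - a)) (by omega)
      have h5 := hX (Z - 1 - b) (X - 1 - (Z - 1 - b)) (by omega)
      have h6 := hY.pal (X - 1 - (Z - 1 - a)) (X - 1 - (Z - 1 - b)) (by omega)
      grind
    omega
  · by_contra! hlt
    have hV2 : V ≤ 2 * Z + 1 := by omega
    rcases hV2.eq_or_lt with hV2 | hV2
    · have h1 := hV.pal Z Z (by omega)
      have := hY.min (2 * X + 1) (by omega) (by omega) fun a b ha hb hab => by
        obtain rfl : a = X := by omega
        obtain rfl : b = a := by omega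
        grind
      omega
    obtain ⟨N, hN⟩ : ∃ N, N + V = 2 * Z := ⟨2 * Z - V, by omega⟩
    have hpal : PalAt W k N := fun a b hab => by
      have h1 := hZ.pal a (Z - 1 - a) (by omega)
      have h2 := hZ.pal b (Z - 1 - b) (by omega)
      have h4 := hV.pal (Z - 1 - a) (Z - 1 - b) (by omega)
      grind
    have hnext : W N = W Z := by
      have h1 := hZ.pal N (Z - 1 - N) (by omega)
      have h2 := hV.pal (Z - 1 - N) Z (by omega)
      grind
    rcases lt_trichotomy N X with hNX | rfl | hNX
    · have key : ∀ b, X + b + 1 = 2 * X - N → W X + W b + j = 0 := fun b hb => by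
        have h1 := hX b N (by omega)
        grind
      have := hY.min (2 * X - N) (by omega) (by omega) fun a b ha hb hab => by
        rcases ha.eq_or_lt with rfl | ha
        · exact key b hab
        rcases hb.eq_or_lt with rfl | hb
        · rw [add_comm (W a)]
          exact key a (by omega)
        have h1 := hX a (X - 1 - a) (by omega)
        have h2 := hX b (X - 1 - b) (by omega)
        have h4 := hpal (X - 1 - a) (X - 1 - b) (by omega)
        grind
      omega
    · exact hik (by grind)
    · rcases hnorm k N hNX (by omega) hpal with rfl | rfl
      · exact hjk (by grind)
      · omega

theorem twisted_period {d : ℕ} (hs : i + j + k = 0)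
    (hd : d ≤ X + 2)
    (hY : PalAt W j (X + d)) (hZ : PalAt W k (X + 2 * d)) (hV : PalAt W k (X + 5 * d))
    (hYZ : j + W (X + d) = k + W (X + 2 * d)) {a : ℕ} (ha : a + d < X + 5 * d) :
    W (a + d) = W a + (i - j) := by
  have h3 := letter_three_eq_zero
  have low : ∀ a, a ≤ X + d → W (a + d) = W a + (i - j) := fun a ha => by
    rcases ha.eq_or_lt with rfl | ha
    · rw [show X + d + d = X + 2 * d by ring]
      grind
    have h1 := hY a (X + d - 1 - a) (by omega)
    have h2 := hZ (a + d) (X + d - 1 - a) (by omega)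
    grind
  have per : ∀ a, a < X + 2 * d → W (a + 3 * d) = W a := fun a ha => by
    have h1 := hZ a (X + 2 * d - 1 - a) (by omega)
    have h2 := hV (a + 3 * d) (X + 2 * d - 1 - a) (by omega)
    grind
  have mid : ∀ a, 2 * d ≤ a → a ≤ X + 2 * d → W (a + d) = W a + (i - j) := fun a h1 h2 => by
    obtain ⟨e, rfl⟩ := Nat.exists_eq_add_of_le' h1
    have h4 := low e (by omega)
    have h5 := low (e + d) (by omega)
    have h6 : W (e + 3 * d) = W e := by
      rcases Nat.eq_zero_or_pos d with rfl | hd0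
      · simp
      · exact per e (by omega)
    rw [show e + 2 * d + d = e + 3 * d by ring, show e + 2 * d = e + d + d by ring]
    grind
  have mirror : ∀ b, a + d + b + 1 = X + 5 * d → W (b + d) = W b + (i - j) →
      W (a + d) = W a + (i - j) := fun b hb h => by
    have h1 := hV (a + d) b (by omega)
    have h2 := hV a (b + d) (by omega)
    grind
  by_cases h1 : a ≤ X + d
  · exact low a h1
  by_cases h2 : 2 * d ≤ a ∧ a ≤ X + 2 * d
  · exact mid a h2.1 h2.2
  refine mirror (X + 4 * d - 1 - a) (by omega) ?_
  by_cases h1 : X + 4 * d - 1 - a ≤ X + d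
  · exact low _ h1
  · exact mid _ (by omega) (by omega)


theorem PalAt.add {d N : ℕ} {s r : Letter} (hT : ∀ a, a + d < V → W (a + d) = W a + r)
    (h : PalAt W s N) (hd : d ≤ N) (hV : N + d ≤ V) : PalAt W (s - r) (N + d) := fun a b hab => by
  rcases le_or_gt d a with ha | ha
  · obtain ⟨a, rfl⟩ := Nat.exists_eq_add_of_le' ha
    have h1 := h a b (by omega)
    have h2 := hT a (by omega)
    grind
  · obtain ⟨b, rfl⟩ := Nat.exists_eq_add_of_le' (show d ≤ b by omega)
    have h1 := h a b (by omega)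
    have h2 := hT b (by omega)
    grind

theorem PalAt.sub {d N : ℕ} {s r : Letter} (hT : ∀ a, a + d < V → W (a + d) = W a + r)
    (h : PalAt W s N) (hd : d < N) (hV : N ≤ V) : PalAt W (s + r) (N - d) := fun a b hab => by
  have h1 := h (a + d) b (by omega)
  have h2 := hT a (by omega)
  grind

theorem not_reversal_of_twisted_period {d N : ℕ} {r : Letter} (hr : r ≠ 0)
    (hT : ∀ a, a + d < V → W (a + d) = W a + r) (hd : d < N) (hV : N ≤ V)
    (h : ∀ a b, a + b + 1 = N → W a = W b) : False := by
  have h3 := letter_three_eq_zero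
  have h1 := h (0 + d) (N - 1 - d) (by omega)
  have h2 := h (N - 1 - d + d) 0 (by omega)
  have h4 := hT 0 (by omega)
  have h5 := hT (N - 1 - d) (by omega)
  exact hr (by grind)

theorem missed_length {d N : ℕ} {s r : Letter}
    (hT : ∀ a, a + d < X + 5 * d → W (a + d) = W a + r) (hd : 0 < d)
    (hnorm : ∀ s N, X < N → N ≤ X + 2 * d → PalAt W s N → N = X + d ∨ N = X + 2 * d)
    (hN : X + 2 * d < N) (hNV : N < X + 5 * d) (h : PalAt W s N) :
    N = X + 3 * d ∨ N = X + 4 * d := by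
  have h1 := h.sub hT (by omega) hNV.le
  have h2 := h1.sub hT (by omega) (by omega)
  by_cases c1 : N ≤ X + 3 * d
  · have := hnorm _ _ (by omega) (by omega) h1
    omega
  by_cases c2 : N ≤ X + 4 * d
  · have := hnorm _ _ (by omega) (by omega) h2
    omega
  have := hnorm _ _ (by omega) (by omega) (h2.sub hT (by omega) (by omega))
  omega

end Core

section Words

variable {W : ℕ → Letter}

@[simp]
theorem length_pre (N : ℕ) : (pre W N).length = N := by simp [pre]

@[simp]
theorem getElem_pre {N a : ℕ} (h : a < (pre W N).length) : (pre W N)[a] = W a := by simp [pre]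

@[simp]
theorem AM.length_apply (t : AM) (u : Word) : (t.apply u).length = u.length := by
  simp [AM.apply]

theorem AM.getElem_apply (t : AM) (u : Word) {a : ℕ} (h : a < (t.apply u).length) :
    (t.apply u)[a] = t.letter (u[u.length - 1 - a]'(by simp at h; omega)) := by
  simp [AM.apply]

theorem apply_pre_eq_iff (t : AM) (N : ℕ) :
    t.apply (pre W N) = pre W N ↔ ∀ a b, a + b + 1 = N → W a = t.letter (W b) := by
  constructor
  · intro h a b hab
    have h1 := List.getElem_of_eq h (i := a) (by simp; omega)
    rw [AM.getElem_apply] at h1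
    simp only [length_pre, getElem_pre] at h1
    rw [← h1, show N - 1 - a = b by omega]
  · intro h
    refine List.ext_getElem (by simp) fun a h1 h2 => ?_
    rw [AM.getElem_apply]
    simp only [length_pre, getElem_pre] at h2 ⊢
    exact (h a _ (by omega)).symm

theorem eq_letter_E_iff (s a b : Letter) : a = (AM.E s).letter b ↔ a + b + s = 0 := by
  revert s a b
  decide

theorem apply_E_pre_eq_iff (s : Letter) (N : ℕ) :
    (AM.E s).apply (pre W N) = pre W N ↔ PalAt W s N := by
  simp only [apply_pre_eq_iff, eq_letter_E_iff, PalAt]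

theorem take_pre {M N : ℕ} (h : M ≤ N) : (pre W N).take M = pre W M :=
  List.ext_getElem (by simp [h]) fun a h1 h2 => by simp

theorem pre_prefix_pre {M N : ℕ} (h : M ≤ N) : pre W M <+: pre W N :=
  take_pre (W := W) h ▸ List.take_prefix _ _

theorem eq_pre_of_prefix {v : Word} {N : ℕ} (h : v <+: pre W N) : v = pre W v.length := by
  rw [← take_pre (by simpa using h.length_le)]
  exact List.prefix_iff_eq_take.1 h

theorem pre_succ (M : ℕ) : pre W (M + 1) = pre W M ++ [W M] := by
  simp [pre, List.range_succ]

theorem pre_getD_prefix {u v : Word} (h : u <+: v) : u = pre (fun a => v.getD a 0) u.length :=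
  List.ext_getElem (by simp) fun a h1 h2 => by
    have := h.length_le
    simp [h.getElem h1, List.getElem?_eq_getElem (show a < v.length by omega)]

theorem rmSuf_pre_append {N M : ℕ} {q r : Word} (hq : N = M + q.length)
    (hr : ∀ (a : ℕ) (h : a < r.length), r[a] = W (M + a)) :
    rmSuf (pre W N) q ++ r = pre W (M + r.length) := by
  rw [rmSuf, length_pre, take_pre (by omega), show N - q.length = M by omega]
  refine List.ext_getElem (by simp) fun a h1 h2 => ?_
  rw [List.getElem_append]
  split
  · simp
  · rename_i h
    simp only [length_pre] at h
    rw [hr, getElem_pre]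
    congr 1
    simp only [length_pre]
    omega

theorem IsPalClosure.closureAt {s : Letter} {M N : ℕ}
    (h : IsPalClosure (AM.E s) (pre W (M + 1)) (pre W N)) : ClosureAt W s M N where
  lt := by simpa using h.1.length_le
  pal := (apply_E_pre_eq_iff s N).1 h.2.1
  min N' h1 h2 h3 := by
    set F : ℕ → Letter := fun a => if a ≤ M then W a else (AM.E s).letter (W (N' - 1 - a)) with hF
    have hpre : pre W (M + 1) <+: pre F N' := by
      have : pre W (M + 1) = pre F (M + 1) :=
        List.ext_getElem (by simp) fun a h4 h5 => by
          simp only [length_pre] at h4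
          simp [hF, show a ≤ M by omega]
      rw [this]
      exact pre_prefix_pre h1
    have hpal : PalAt F s N' := fun a b hab => by
      rcases le_or_gt a M with ha | ha <;> rcases le_or_gt b M with hb | hb
      · simpa [hF, ha, hb] using h3 a b ha hb hab
      · simp [hF, ha, hb.not_ge, AM.letter, show N' - 1 - b = a by omega]
      · simp [hF, ha.not_ge, hb, AM.letter, show N' - 1 - a = b by omega]
      · omega
    simpa using h.2.2 _ hpre ((apply_E_pre_eq_iff s N').2 hpal)

end Words

/-- Theorem (last factor rule, converse direction): if the prefix of length `n`
of the directive bi-sequence is normalized,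
`(ϑ_{n-2}, ϑ_{n-1}, ϑ_n, ϑ_{n+1}) = (E_i, E_j, E_k, E_k)` for pairwise distinct
`i, j, k` and `E_i(δ_{n-1}) = E_j(δ_n) = E_k(δ_{n+1})`, then exactly two
pseudopalindromic prefixes are missed between `w n` and `w (n+1)`; they are the
explicitly described `E_i`-palindrome `u₂` and `E_j`-palindrome `u₃`, and
`w (n+1)` equals the explicitly described word `u₄`. -/
theorem two_missed_from_factor_form
    (Δ : ℕ → Letter) (Θ : ℕ → AM) (w : ℕ → Word)
    (hw : DirectivePrefixes Δ Θ w) (n : ℕ) (hn : 3 ≤ n)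
    (hnorm : NormalizedUpTo w n)
    (i j k : Letter) (hij : i ≠ j) (hjk : j ≠ k) (hik : i ≠ k)
    (hΘ : Θ (n - 2) = AM.E i ∧ Θ (n - 1) = AM.E j ∧
      Θ n = AM.E k ∧ Θ (n + 1) = AM.E k)
    (hΔ : (AM.E i).letter (Δ (n - 1)) = (AM.E j).letter (Δ n) ∧
      (AM.E j).letter (Δ n) = (AM.E k).letter (Δ (n + 1))) :
    let u₁ := rmSuf (w (n - 1)) ((AM.E j).apply (w (n - 2))) ++
      (AM.E k).apply (w (n - 1))
    let u₂ := rmSuf u₁ ((AM.E k).apply (w (n - 2))) ++ (AM.E i).apply (w (n - 1))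
    let u₃ := rmSuf u₂ (w (n - 2)) ++ w (n - 1)
    let u₄ := rmSuf u₃ ((AM.E j).apply (w (n - 2))) ++ (AM.E k).apply (w (n - 1))
    w (n + 1) = u₄ ∧ u₂ ≠ u₃ ∧
      (∀ v : Word, MissedBetween (w n) (w (n + 1)) v ↔ (v = u₂ ∨ v = u₃)) ∧
      (AM.E i).apply u₂ = u₂ ∧ (AM.E j).apply u₃ = u₃ := by
  obtain ⟨m, rfl⟩ := Nat.exists_eq_add_of_le' hn
  rw [show m + 3 - 2 = m + 1 by omega, show m + 3 - 1 = m + 2 by omega] at *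
  obtain ⟨-, hcl⟩ := hw
  have hmono : ∀ {a b}, a ≤ b → w a <+: w b := fun {a b} hab => by
    induction b, hab using Nat.le_induction with
    | base => exact List.prefix_rfl
    | succ b _ ih => exact ih.trans ((List.prefix_append _ _).trans (hcl b).1)
  have hlen : StrictMono fun a => (w a).length :=
    strictMono_nat_of_lt_succ fun a => by simpa using (hcl a).1.length_le
  obtain ⟨W, hW⟩ : ∃ W : ℕ → Letter, ∀ a ≤ m + 4, w a = pre W (w a).length :=
    ⟨_, fun a ha => pre_getD_prefix (hmono ha)⟩
  have hδ : ∀ a ≤ m + 3, Δ (a + 1) = W (w a).length := fun a ha => by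
    have h1 := (hcl a).1
    rw [hW (a + 1) (by omega)] at h1
    have h2 := eq_pre_of_prefix h1
    rw [List.length_append, List.length_singleton, pre_succ, ← hW a (by omega)] at h2
    simpa using h2
  have hclosure : ∀ a ≤ m + 3, ∀ s, Θ (a + 1) = AM.E s →
      ClosureAt W s (w a).length (w (a + 1)).length := fun a ha s hs => by
    apply IsPalClosure.closureAt
    have h1 := hcl a
    rwa [hs, hδ a ha, hW (a + 1) (by omega), show w a ++ [W (w a).length] =
      pre W ((w a).length + 1) by rw [pre_succ, ← hW a (by omega)]] at h1
  have hY := hclosure (m + 1) (by omega) j hΘ.2.1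
  have hZ := hclosure (m + 2) (by omega) k hΘ.2.2.1
  have hV := hclosure (m + 3) (by omega) k hΘ.2.2.2
  have hX := (hclosure m (by omega) i hΘ.1).pal
  rw [hδ (m + 1) (by omega), hδ (m + 2) (by omega), hδ (m + 3) (by omega)] at hΔ
  have hs : i + j + k = 0 := by
    clear * - hij hjk hik
    decide +revert
  have hr : i - j ≠ 0 := sub_ne_zero.2 hij
  have h3 := letter_three_eq_zero
  have hWX := hW (m + 1) (by omega)
  have hWY := hW (m + 2) (by omega)
  have hWZ := hW (m + 3) (by omega)
  have hWV := hW (m + 4) (by omega)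
  have hnorm' : ∀ s N, (w (m + 1)).length < N → N ≤ (w (m + 3)).length → PalAt W s N →
      N = (w (m + 2)).length ∨ N = (w (m + 3)).length := fun s N h1 h2 h => by
    obtain ⟨a, ha, hNa⟩ := hnorm (pre W N) (hWZ ▸ pre_prefix_pre h2)
      ⟨AM.E s, (apply_E_pre_eq_iff s N).2 h⟩
    obtain rfl : N = (w a).length := by simpa using congrArg List.length hNa
    have := hlen.lt_iff_lt.1 h1
    obtain rfl | rfl : a = m + 2 ∨ a = m + 3 := by omega
    · exact .inl rfl
    · exact .inr rfl
  rw [show m + 3 + 1 = m + 4 by omega] at *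
  rw [show m + 2 + 1 = m + 3 by omega] at *
  rw [show m + 1 + 1 = m + 2 by omega] at *
  generalize (w (m + 1)).length = X at *
  generalize (w (m + 2)).length = Y at *
  generalize (w (m + 3)).length = Z at *
  generalize (w (m + 4)).length = V at *
  simp only [hWX, hWY, hWZ, hWV]
  simp only [AM.letter, neg_inj] at hΔ
  have hZX := second_length hs hX hY hZ hΔ.1 hnorm'
  have hVX := third_length hs hjk hik hX hY hZ hV hΔ.1 hΔ.2 hZX hnorm'
  obtain ⟨d, hd, rfl⟩ : ∃ d, 0 < d ∧ Y = X + d := by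
    have := hY.lt
    exact ⟨Y - X, by omega, by omega⟩
  obtain rfl : Z = X + 2 * d := by omega
  obtain rfl : V = X + 5 * d := by omega
  have hT : ∀ a, a + d < X + 5 * d → W (a + d) = W a + (i - j) := fun a =>
    twisted_period hs (by have := hY.le; omega) hY.pal hZ.pal hV.pal hΔ.2
  have h3d : PalAt W i (X + 3 * d) := by
    have := hZ.pal.add hT (by omega) (by omega)
    rwa [show k - (i - j) = i by grind, show X + 2 * d + d = X + 3 * d by ring] at this
  have h4d : PalAt W j (X + 4 * d) := by
    have := h3d.add hT (by omega) (by omega)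
    rwa [sub_sub_cancel, show X + 3 * d + d = X + 4 * d by ring] at this
  have hstep : ∀ (M N L : ℕ) (s : Letter) (q : Word), q.length = X → N = X + M → L = X + M + d →
      (∀ a b, a + b + 1 = X + d → W (a + M) + W b + s = 0) →
      rmSuf (pre W N) q ++ (AM.E s).apply (pre W (X + d)) = pre W L :=
    fun M N L s q hq hN hL h => by
      rw [rmSuf_pre_append (W := W) (M := M) (by omega), AM.length_apply, length_pre,
        show M + (X + d) = L by omega]
      intro a ha
      rw [AM.length_apply, length_pre] at ha
      rw [AM.getElem_apply, getElem_pre, length_pre, eq_comm, eq_letter_E_iff, add_comm M]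
      exact h a _ (by omega)
  have hP2 : ∀ a, a < X + d → W (a + 2 * d) = W a + 2 * (i - j) := fun a ha => by
    have h1 := hT a (by omega)
    have h2 := hT (a + d) (by omega)
    rw [show a + 2 * d = a + d + d by ring]
    grind
  have hP3 : ∀ a, a < X + d → W (a + 3 * d) = W a := fun a ha => by
    have h1 := hP2 a ha
    have h2 := hT (a + 2 * d) (by omega)
    rw [show a + 3 * d = a + 2 * d + d by ring]
    grind
  have hP4 : ∀ a, a < X + d → W (a + 4 * d) = W a + (i - j) := fun a ha => by
    have h1 := hP3 a ha
    have h2 := hT (a + 3 * d) (by omega)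
    rw [show a + 4 * d = a + 3 * d + d by ring]
    grind
  have hu₁ := hstep d (X + d) (X + 2 * d) k ((AM.E j).apply (pre W X)) (by simp) rfl (by ring)
    fun a b hab => by
      have h1 := hY.pal a b hab
      have h2 := hT a (by omega)
      grind
  have hu₂ := hstep (2 * d) (X + 2 * d) (X + 3 * d) i ((AM.E k).apply (pre W X)) (by simp) rfl
    (by ring) fun a b hab => by
      have h1 := hY.pal a b hab
      have h2 := hP2 a (by omega)
      grind
  have hu₃ := hstep (3 * d) (X + 3 * d) (X + 4 * d) j (pre W X) (by simp) rfl
    (by ring) fun a b hab => by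
      have h1 := hY.pal a b hab
      have h2 := hP3 a (by omega)
      grind
  have hu₄ := hstep (4 * d) (X + 4 * d) (X + 5 * d) k ((AM.E j).apply (pre W X)) (by simp) rfl
    (by ring) fun a b hab => by
      have h1 := hY.pal a b hab
      have h2 := hP4 a (by omega)
      grind
  rw [(apply_E_pre_eq_iff j (X + d)).2 hY.pal] at hu₃
  simp only [hu₁, hu₂, hu₃, hu₄, true_and]
  refine ⟨fun h => ?_, fun v => ⟨?_, ?_⟩, (apply_E_pre_eq_iff _ _).2 h3d,
    (apply_E_pre_eq_iff _ _).2 h4d⟩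
  · have := congrArg List.length h
    simp only [length_pre] at this
    omega
  · rintro ⟨hpre, ⟨t, ht⟩, h1, h2⟩
    rw [length_pre] at h1 h2
    have hv := eq_pre_of_prefix hpre
    generalize v.length = N at *
    subst hv
    cases t with
    | R =>
      exact (not_reversal_of_twisted_period hr hT (by omega) h2.le
        ((apply_pre_eq_iff _ _).1 ht)).elim
    | E s =>
      rcases missed_length hT hd hnorm' h1 h2 ((apply_E_pre_eq_iff _ _).1 ht) with rfl | rfl
      · exact .inl rfl
      · exact .inr rfl
  · rintro (rfl | rfl)
    · exact ⟨pre_prefix_pre (by omega), ⟨_, (apply_E_pre_eq_iff _ _).2 h3d⟩,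
        by simp only [length_pre]; omega, by simp only [length_pre]; omega⟩
    · exact ⟨pre_prefix_pre (by omega), ⟨_, (apply_E_pre_eq_iff _ _).2 h4d⟩,
        by simp only [length_pre]; omega, by simp only [length_pre]; omega⟩
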